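/- Assume that the family of random variables ζ_n(ω) := (n/T)^{1/2} ∫₀^T |μ_s(ω) − μ_{⌊sn/T⌋ T/n}(ω)| ds, n ≥ 1, is bounded in probability. Then for every α ∈ (0, 1/3), ε^{−α} · sup_{t ∈ [0, T]} |X^ε_t − X̄_t| → 0 in probability as ε → 0⁺. -/

import Mathlib

open intervalIntegral Filter MeasureTheory

/-- `Y : ℝ → ℝ` is a continuous solution on `[0, T]` of the (Doss–Sussmann transformed)
integral equation
`Y t = H (0, x₀) + ∫₀^t (∂H/∂x) (m s, F (m s, Y s)) · b (F (m s, Y s), s / ε) ds`. -/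
def SolvesAveragingODE (F H : ℝ × ℝ → ℝ) (b : ℝ × ℝ → ℝ) (m : ℝ → ℝ)
    (T x₀ ε : ℝ) (Y : ℝ → ℝ) : Prop :=
  ContinuousOn Y (Set.Icc 0 T) ∧
  ∀ t ∈ Set.Icc (0:ℝ) T,
    Y t = H (0, x₀) + ∫ s in (0:ℝ)..t,
      deriv (fun y : ℝ => H (m s, y)) (F (m s, Y s)) * b (F (m s, Y s), s / ε)

/-- A family of random variables `ξ i` is bounded in probability if
`sup_i P (|ξ i| ≥ c) → 0` as `c → ∞`. -/
def BoundedInProbability {Ω : Type*} {ι : Type*} [MeasurableSpace Ω]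
    (P : Measure Ω) (ξ : ι → Ω → ℝ) : Prop :=
  Tendsto (fun c : ℝ => ⨆ i : ι, P {ω | c ≤ |ξ i ω|}) atTop (nhds 0)


/-- A family of functions of two real variables that is bounded and Lipschitz on every square
`[-R, R]²`, uniformly in the parameter. -/
def BoxLipschitz {ι : Type*} (f : ι → ℝ → ℝ → ℝ) : Prop :=
  ∀ R : ℝ, 0 ≤ R → ∃ C : ℝ, 0 ≤ C ∧ ∀ i r r' x x', |r| ≤ R → |r'| ≤ R → |x| ≤ R → |x'| ≤ R →
    |f i r x| ≤ C ∧ |f i r x - f i r' x'| ≤ C * (|r - r'| + |x - x'|)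

namespace BoxLipschitz

variable {ι : Type*} {f g : ι → ℝ → ℝ → ℝ}

theorem mul (hf : BoxLipschitz f) (hg : BoxLipschitz g) :
    BoxLipschitz fun i r x => f i r x * g i r x := by
  intro R hR
  obtain ⟨C, hC, hf⟩ := hf R hR
  obtain ⟨D, hD, hg⟩ := hg R hR
  refine ⟨C * D + (C * D + C * D), by positivity, fun i r r' x x' hr hr' hx hx' => ?_⟩
  have hCD : 0 ≤ C * D := by positivity
  obtain ⟨f1, f2⟩ := hf i r r' x x' hr hr' hx hx'
  obtain ⟨g1, g2⟩ := hg i r r' x x' hr hr' hx hx'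
  have g3 := (hg i r' r x' x hr' hr hx' hx).1
  constructor
  · rw [abs_mul]
    have := mul_le_mul f1 g1 (abs_nonneg _) hC
    linarith
  · have key : f i r x * g i r x - f i r' x' * g i r' x'
        = f i r x * (g i r x - g i r' x') + (f i r x - f i r' x') * g i r' x' := by ring
    have hs : 0 ≤ |r - r'| + |x - x'| := by positivity
    rw [key]
    refine (abs_add_le _ _).trans ?_
    rw [abs_mul, abs_mul]
    have h1 := mul_le_mul f1 g2 (abs_nonneg _) hC
    have h2 := mul_le_mul f2 g3 (abs_nonneg _) (by positivity)
    have h3 := mul_nonneg hCD hs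
    linarith

theorem sub (hf : BoxLipschitz f) (hg : BoxLipschitz g) :
    BoxLipschitz fun i r x => f i r x - g i r x := by
  intro R hR
  obtain ⟨C, hC, hf⟩ := hf R hR
  obtain ⟨D, hD, hg⟩ := hg R hR
  refine ⟨C + D, by positivity, fun i r r' x x' hr hr' hx hx' => ?_⟩
  obtain ⟨f1, f2⟩ := hf i r r' x x' hr hr' hx hx'
  obtain ⟨g1, g2⟩ := hg i r r' x x' hr hr' hx hx'
  constructor
  · exact (abs_sub _ _).trans (add_le_add f1 g1)
  · have key : f i r x - g i r x - (f i r' x' - g i r' x')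
        = (f i r x - f i r' x') - (g i r x - g i r' x') := by ring
    rw [key, add_mul]
    exact (abs_sub _ _).trans (add_le_add f2 g2)

theorem comp (hg : BoxLipschitz g) (hf : BoxLipschitz f) :
    BoxLipschitz fun i r x => g i r (f i r x) := by
  intro R hR
  obtain ⟨C, hC, hf⟩ := hf R hR
  obtain ⟨D, hD, hg⟩ := hg (max R C) (hR.trans (le_max_left _ _))
  refine ⟨D * (1 + C), by positivity, fun i r r' x x' hr hr' hx hx' => ?_⟩
  obtain ⟨f1, f2⟩ := hf i r r' x x' hr hr' hx hx'
  have f3 := (hf i r' r x' x hr' hr hx' hx).1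
  obtain ⟨g1, g2⟩ := hg i r r' (f i r x) (f i r' x') (hr.trans (le_max_left _ _))
    (hr'.trans (le_max_left _ _)) (f1.trans (le_max_right _ _)) (f3.trans (le_max_right _ _))
  constructor
  · have : 0 ≤ D * C := by positivity
    linarith
  · have h1 := mul_le_mul_of_nonneg_left f2 hD
    have h2 : 0 ≤ D * |x - x'| := by positivity
    linarith

theorem of_abs_deriv_le {h h' : ℝ → ℝ} (hh : ∀ x, HasDerivAt h (h' x) x) (hc : Continuous h') :
    BoxLipschitz fun (_ : ι) (_ : ℝ) (x : ℝ) => h x := by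
  intro R hR
  obtain ⟨C, hC⟩ := (isCompact_Icc (a := -R) (b := R)).exists_bound_of_continuousOn hc.continuousOn
  obtain ⟨D, hD⟩ := (isCompact_Icc (a := -R) (b := R)).exists_bound_of_continuousOn
    (f := h) (fun x _ => (hh x).continuousAt.continuousWithinAt)
  refine ⟨max |C| |D|, by positivity, fun _ r r' x x' _ _ hx hx' => ⟨?_, ?_⟩⟩
  · exact (hD x (abs_le.1 hx)).trans ((le_abs_self D).trans (le_max_right _ _))
  · have := (convex_Icc (-R) R).norm_image_sub_le_of_norm_hasDerivWithin_le
      (fun y _ => (hh y).hasDerivWithinAt) hC (abs_le.1 hx') (abs_le.1 hx)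
    simp only [Real.norm_eq_abs] at this
    refine this.trans ?_
    gcongr
    · exact (le_abs_self C).trans (le_max_left _ _)
    · linarith [abs_nonneg (r - r')]

theorem continuous {F : ℝ → ℝ → ℝ} (hF : BoxLipschitz fun _ : Unit => F) :
    Continuous fun p : ℝ × ℝ => F p.1 p.2 := by
  rw [continuous_iff_continuousAt]
  rintro ⟨r, x⟩
  obtain ⟨C, hC, h⟩ := hF (max |r| |x| + 1) (by positivity)
  have hlim : Tendsto (fun p : ℝ × ℝ => C * (|p.1 - r| + |p.2 - x|)) (nhds (r, x)) (nhds 0) := by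
    have : Continuous fun p : ℝ × ℝ => C * (|p.1 - r| + |p.2 - x|) := by fun_prop
    simpa using this.tendsto (r, x)
  refine tendsto_iff_norm_sub_tendsto_zero.2 (squeeze_zero' (.of_forall fun _ => norm_nonneg _) ?_ hlim)
  have e1 : ∀ᶠ p : ℝ × ℝ in nhds (r, x), |p.1| < max |r| |x| + 1 :=
    (continuous_fst.abs).continuousAt.eventually_lt continuousAt_const
      (by simpa using (le_max_left |r| |x|).trans_lt (lt_add_one _))
  have e2 : ∀ᶠ p : ℝ × ℝ in nhds (r, x), |p.2| < max |r| |x| + 1 :=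
    (continuous_snd.abs).continuousAt.eventually_lt continuousAt_const
      (by simpa using (le_max_right |r| |x|).trans_lt (lt_add_one _))
  filter_upwards [e1, e2] with p h1 h2
  exact (h () p.1 r p.2 x h1.le ((le_max_left |r| |x|).trans (lt_add_one _).le) h2.le
    ((le_max_right |r| |x|).trans (lt_add_one _).le)).2

end BoxLipschitz

theorem eq_mul_exp_integral_of_hasDerivAt {D q : ℝ → ℝ} (hq : Continuous q)
    (hD : ∀ r, HasDerivAt D (q r * D r) r) (r : ℝ) :
    D r = D 0 * Real.exp (∫ u in (0:ℝ)..r, q u) := by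
  have hQ : ∀ s, HasDerivAt (fun s => ∫ u in (0:ℝ)..s, q u) (q s) s := fun s =>
    hq.integral_hasStrictDerivAt 0 s |>.hasDerivAt
  have hd : ∀ s, HasDerivAt (fun s => D s * Real.exp (-∫ u in (0:ℝ)..s, q u)) 0 s := fun s => by
    have h := (hD s).mul (hQ s).fun_neg.exp
    have e : q s * D s * Real.exp (-∫ u in (0:ℝ)..s, q u) +
        D s * (Real.exp (-∫ u in (0:ℝ)..s, q u) * -q s) = 0 := by ring
    rwa [e] at h
  have := is_const_of_deriv_eq_zero (fun s => (hd s).differentiableAt) (fun s => (hd s).deriv) r 0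
  simp only [integral_same, neg_zero, Real.exp_zero, mul_one] at this
  rw [← this, mul_assoc, ← Real.exp_add]
  simp

theorem abs_sub_sub_deriv_mul_le {σ : ℝ → ℝ} (hσ : ContDiff ℝ 2 σ) {C₂ : ℝ}
    (hC₂ : ∀ x, |deriv (deriv σ) x| ≤ C₂) (x y : ℝ) :
    |deriv σ x - deriv σ y| ≤ C₂ * |x - y| ∧
    |σ y - σ x - deriv σ x * (y - x)| ≤ C₂ * |y - x| * |y - x| := by
  have hd : Differentiable ℝ σ := hσ.differentiable (by norm_num)
  have hd' : Differentiable ℝ (deriv σ) :=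
    ((contDiff_succ_iff_deriv (n := 1)).1 (by simpa [one_add_one_eq_two] using hσ)).2.2.differentiable
      (by norm_num)
  have hlip : ∀ x y, |deriv σ x - deriv σ y| ≤ C₂ * |x - y| := fun x y =>
    convex_univ.norm_image_sub_le_of_norm_deriv_le (fun z _ => hd' z) (fun z _ => hC₂ z)
      (Set.mem_univ y) (Set.mem_univ x)
  refine ⟨hlip x y, ?_⟩
  have h0 : 0 ≤ C₂ := (abs_nonneg _).trans (hC₂ 0)
  have := (convex_uIcc x y).norm_image_sub_le_of_norm_hasDerivWithin_le
    (f := fun z => σ z - deriv σ x * z) (f' := fun z => deriv σ z - deriv σ x) (C := C₂ * |y - x|)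
    (fun z _ => by
      have := (hd z).hasDerivAt.fun_sub ((hasDerivAt_id z).const_mul (deriv σ x))
      simpa using this.hasDerivWithinAt)
    (fun z hz => (hlip z x).trans (by
      exact mul_le_mul_of_nonneg_left (Set.abs_sub_left_of_mem_uIcc hz) h0))
    Set.left_mem_uIcc Set.right_mem_uIcc
  simp only [Real.norm_eq_abs] at this
  convert this using 2
  ring

section Flow

variable {σ : ℝ → ℝ} {C₁ C₂ : ℝ} {F : ℝ × ℝ → ℝ}

theorem abs_integral_zero_le {q : ℝ → ℝ} {C R r : ℝ} (hr : |r| ≤ R)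
    (hq : ∀ u, |u| ≤ R → |q u| ≤ C) : |∫ u in (0:ℝ)..r, q u| ≤ C * |r| := by
  have := norm_integral_le_of_norm_le_const (a := 0) (b := r) (C := C) (f := q) fun u hu => by
    have h := Set.abs_sub_left_of_mem_uIcc (Set.uIoc_subset_uIcc hu)
    simp only [sub_zero] at h
    exact hq u (h.trans hr)
  simpa using this

theorem exists_flow_sub_eq (hσ : ContDiff ℝ 2 σ) (hC₁ : ∀ x, |deriv σ x| ≤ C₁)
    (hC₂ : ∀ x, |deriv (deriv σ) x| ≤ C₂) (hF0 : ∀ x : ℝ, F (0, x) = x)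
    (hFr : ∀ r x : ℝ, HasDerivAt (fun r' : ℝ => F (r', x)) (σ (F (r, x))) r)
    (hinj : ∀ r, Function.Injective fun x => F (r, x)) {x y : ℝ} (hxy : x ≠ y) :
    ∃ q : ℝ → ℝ, Continuous q ∧ (∀ u, |q u| ≤ C₁) ∧
      (∀ u, |q u - deriv σ (F (u, x))| ≤ C₂ * |F (u, y) - F (u, x)|) ∧
      ∀ r, F (r, y) - F (r, x) = (y - x) * Real.exp (∫ u in (0:ℝ)..r, q u) := by
  have hne : ∀ u, F (u, y) - F (u, x) ≠ 0 := fun u h => hxy (hinj u (sub_eq_zero.1 h)).symm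
  have hc : ∀ z, Continuous fun u => F (u, z) := fun z =>
    continuous_iff_continuousAt.2 fun u => (hFr u z).continuousAt
  have hσc : Continuous σ := hσ.continuous
  have hqc : Continuous fun u => (σ (F (u, y)) - σ (F (u, x))) / (F (u, y) - F (u, x)) :=
    ((hσc.comp (hc y)).sub (hσc.comp (hc x))).div ((hc y).sub (hc x)) hne
  refine ⟨_, hqc, fun u => ?_, fun u => ?_, fun r => ?_⟩
  · rw [abs_div, div_le_iff₀ (abs_pos.2 (hne u))]
    exact convex_univ.norm_image_sub_le_of_norm_deriv_le
      (fun z _ => hσ.differentiable (by norm_num) z) (fun z _ => hC₁ z)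
      (Set.mem_univ (F (u, x))) (Set.mem_univ (F (u, y)))
  · have e : (σ (F (u, y)) - σ (F (u, x))) / (F (u, y) - F (u, x)) - deriv σ (F (u, x))
        = (σ (F (u, y)) - σ (F (u, x)) - deriv σ (F (u, x)) * (F (u, y) - F (u, x))) /
          (F (u, y) - F (u, x)) := by
      field_simp [hne u]
    rw [e, abs_div, div_le_iff₀ (abs_pos.2 (hne u))]
    exact (abs_sub_sub_deriv_mul_le hσ hC₂ _ _).2
  · have := eq_mul_exp_integral_of_hasDerivAt (D := fun u => F (u, y) - F (u, x)) hqc (fun u => by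
      have := (hFr u y).fun_sub (hFr u x)
      rwa [div_mul_cancel₀ _ (hne u)]) r
    simpa only [hF0] using this

theorem abs_flow_sub_le (hσ : ContDiff ℝ 2 σ) (hC₁ : ∀ x, |deriv σ x| ≤ C₁)
    (hC₂ : ∀ x, |deriv (deriv σ) x| ≤ C₂) (hF0 : ∀ x : ℝ, F (0, x) = x)
    (hFr : ∀ r x : ℝ, HasDerivAt (fun r' : ℝ => F (r', x)) (σ (F (r, x))) r)
    (hinj : ∀ r, Function.Injective fun x => F (r, x)) {R r : ℝ} (hr : |r| ≤ R) (x y : ℝ) :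
    |F (r, y) - F (r, x)| ≤ Real.exp (C₁ * R) * |y - x| ∧
    |y - x| ≤ Real.exp (C₁ * R) * |F (r, y) - F (r, x)| := by
  rcases eq_or_ne x y with rfl | hxy
  · simp
  obtain ⟨q, -, hq, -, hF⟩ := exists_flow_sub_eq hσ hC₁ hC₂ hF0 hFr hinj hxy
  have h1 := abs_integral_zero_le (R := |r|) le_rfl (fun u _ => hq u)
  have h2 : C₁ * |r| ≤ C₁ * R := mul_le_mul_of_nonneg_left hr ((abs_nonneg _).trans (hC₁ 0))
  have h3 := abs_le.1 (h1.trans h2)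
  rw [hF, abs_mul, Real.abs_exp]
  constructor
  · rw [mul_comm]
    gcongr
    exact h3.2
  · have : Real.exp 0 ≤ Real.exp (C₁ * R) * Real.exp (∫ u in (0:ℝ)..r, q u) := by
      rw [← Real.exp_add]
      gcongr
      linarith [h3.1]
    rw [Real.exp_zero] at this
    nlinarith [abs_nonneg (y - x)]

theorem boxLipschitz_flow (hσ : ContDiff ℝ 2 σ) (hC₁ : ∀ x, |deriv σ x| ≤ C₁)
    (hC₂ : ∀ x, |deriv (deriv σ) x| ≤ C₂) (hF0 : ∀ x : ℝ, F (0, x) = x)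
    (hFr : ∀ r x : ℝ, HasDerivAt (fun r' : ℝ => F (r', x)) (σ (F (r, x))) r)
    (hinj : ∀ r, Function.Injective fun x => F (r, x)) {ι : Type*} :
    BoxLipschitz fun (_ : ι) r x => F (r, x) := by
  intro R hR
  obtain ⟨S, hS⟩ := (isCompact_Icc (a := -R) (b := R)).exists_bound_of_continuousOn
    (f := fun u => F (u, 0)) (fun u _ => (hFr u 0).continuousAt.continuousWithinAt)
  have hbd : ∀ r x, |r| ≤ R → |x| ≤ R → |F (r, x)| ≤ S + Real.exp (C₁ * R) * R := by
    intro r x hr hx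
    have h1 := (abs_flow_sub_le hσ hC₁ hC₂ hF0 hFr hinj hr 0 x).1
    have h2 := hS r (abs_le.1 hr)
    rw [Real.norm_eq_abs] at h2
    have h3 : Real.exp (C₁ * R) * |x - 0| ≤ Real.exp (C₁ * R) * R := by
      rw [sub_zero]
      gcongr
    have h4 := abs_add_le (F (r, x) - F (r, 0)) (F (r, 0))
    rw [sub_add_cancel] at h4
    linarith
  set S' := S + Real.exp (C₁ * R) * R
  have hS' : 0 ≤ S' := (abs_nonneg _).trans (hbd 0 0 (by simpa) (by simpa))
  obtain ⟨V, hV⟩ := (isCompact_Icc (a := -S') (b := S')).exists_bound_of_continuousOn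
    hσ.continuous.continuousOn
  have hV0 : 0 ≤ V := (norm_nonneg _).trans (hV 0 ⟨by linarith, hS'⟩)
  refine ⟨S' + V + Real.exp (C₁ * R), by positivity, fun _ r r' x x' hr hr' hx hx' => ⟨?_, ?_⟩⟩
  · linarith [hbd r x hr hx, Real.exp_pos (C₁ * R)]
  · have h1 := (abs_flow_sub_le hσ hC₁ hC₂ hF0 hFr hinj hr' x' x).1
    have h2 := (convex_Icc (-R) R).norm_image_sub_le_of_norm_hasDerivWithin_le
      (f := fun u => F (u, x)) (fun u _ => (hFr u x).hasDerivWithinAt)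
      (fun u hu => hV _ (abs_le.1 (hbd u x (abs_le.2 hu) hx))) (abs_le.1 hr') (abs_le.1 hr)
    simp only [Real.norm_eq_abs] at h2
    have h3 := abs_sub_le (F (r, x)) (F (r', x)) (F (r', x'))
    have h4 : 0 ≤ S' * (|r - r'| + |x - x'|) := by positivity
    have h5 : 0 ≤ Real.exp (C₁ * R) * |r - r'| := by positivity
    have h6 : 0 ≤ V * |x - x'| := by positivity
    linarith

theorem boxLipschitz_integral_deriv_flow (hσ : ContDiff ℝ 2 σ) (hC₁ : ∀ x, |deriv σ x| ≤ C₁)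
    (hC₂ : ∀ x, |deriv (deriv σ) x| ≤ C₂) (hF0 : ∀ x : ℝ, F (0, x) = x)
    (hFr : ∀ r x : ℝ, HasDerivAt (fun r' : ℝ => F (r', x)) (σ (F (r, x))) r)
    (hinj : ∀ r, Function.Injective fun x => F (r, x)) {ι : Type*} :
    BoxLipschitz fun (_ : ι) r x => ∫ u in (0:ℝ)..r, deriv σ (F (u, x)) := by
  intro R hR
  have hc : ∀ z, Continuous fun u => deriv σ (F (u, z)) := fun z =>
    (hσ.continuous_deriv (by norm_num)).comp
      (continuous_iff_continuousAt.2 fun u => (hFr u z).continuousAt)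
  have h10 : 0 ≤ C₁ := (abs_nonneg _).trans (hC₁ 0)
  have h20 : 0 ≤ C₂ := (abs_nonneg _).trans (hC₂ 0)
  refine ⟨C₁ * R + C₁ + C₂ * Real.exp (C₁ * R) * R, by positivity,
    fun _ r r' x x' hr hr' hx hx' => ⟨?_, ?_⟩⟩
  · have h1 := abs_integral_zero_le (R := R) hr (fun u _ => hC₁ (F (u, x)))
    have h2 : C₁ * |r| ≤ C₁ * R := by gcongr
    have h3 : 0 ≤ C₂ * Real.exp (C₁ * R) * R := by positivity
    linarith
  · have e : (∫ u in (0:ℝ)..r, deriv σ (F (u, x))) - ∫ u in (0:ℝ)..r', deriv σ (F (u, x'))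
        = (∫ u in r'..r, deriv σ (F (u, x)))
          + ∫ u in (0:ℝ)..r', (deriv σ (F (u, x)) - deriv σ (F (u, x'))) := by
      rw [intervalIntegral.integral_sub ((hc x).intervalIntegrable _ _)
        ((hc x').intervalIntegrable _ _),
        ← integral_add_adjacent_intervals ((hc x).intervalIntegrable 0 r')
          ((hc x).intervalIntegrable r' r)]
      ring
    have h1 : |∫ u in r'..r, deriv σ (F (u, x))| ≤ C₁ * |r - r'| :=
      norm_integral_le_of_norm_le_const (f := fun u => deriv σ (F (u, x))) fun u _ => hC₁ _
    have h2 := abs_integral_zero_le (q := fun u => deriv σ (F (u, x)) - deriv σ (F (u, x')))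
      (C := C₂ * (Real.exp (C₁ * R) * |x - x'|)) hr' fun u hu =>
      ((abs_sub_sub_deriv_mul_le hσ hC₂ _ _).1.trans (by
        gcongr
        exact (abs_flow_sub_le hσ hC₁ hC₂ hF0 hFr hinj hu x' x).1))
    have h3 : C₂ * (Real.exp (C₁ * R) * |x - x'|) * |r'|
        ≤ C₂ * (Real.exp (C₁ * R) * |x - x'|) * R := by gcongr
    rw [e]
    refine (abs_add_le _ _).trans ?_
    have h4 : 0 ≤ C₁ * R * (|r - r'| + |x - x'|) := by positivity
    have h5 : 0 ≤ C₁ * |x - x'| := by positivity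
    have h6 : 0 ≤ C₂ * Real.exp (C₁ * R) * R * |r - r'| := by positivity
    linarith

theorem hasDerivAt_flow (hσ : ContDiff ℝ 2 σ) (hC₁ : ∀ x, |deriv σ x| ≤ C₁)
    (hC₂ : ∀ x, |deriv (deriv σ) x| ≤ C₂) (hF0 : ∀ x : ℝ, F (0, x) = x)
    (hFr : ∀ r x : ℝ, HasDerivAt (fun r' : ℝ => F (r', x)) (σ (F (r, x))) r)
    (hinj : ∀ r, Function.Injective fun x => F (r, x)) (r x : ℝ) :
    HasDerivAt (fun y => F (r, y)) (Real.exp (∫ u in (0:ℝ)..r, deriv σ (F (u, x)))) x := by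
  have hc : Continuous fun u => deriv σ (F (u, x)) :=
    (hσ.continuous_deriv (by norm_num)).comp
      (continuous_iff_continuousAt.2 fun u => (hFr u x).continuousAt)
  have h20 : 0 ≤ C₂ := (abs_nonneg _).trans (hC₂ 0)
  rw [hasDerivAt_iff_tendsto_slope]
  have hlim : Tendsto (fun y => Real.log (slope (fun y => F (r, y)) x y)) (nhdsWithin x {x}ᶜ)
      (nhds (∫ u in (0:ℝ)..r, deriv σ (F (u, x)))) := by
    refine tendsto_iff_norm_sub_tendsto_zero.2 (squeeze_zero'
      (g := fun y => C₂ * (Real.exp (C₁ * |r|) * |y - x|) * |r|)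
      (.of_forall fun _ => norm_nonneg _) ?_ ?_)
    · filter_upwards [self_mem_nhdsWithin] with y hy
      obtain ⟨q, hqc, -, hq, hF⟩ :=
        exists_flow_sub_eq hσ hC₁ hC₂ hF0 hFr hinj (Ne.symm hy : x ≠ y)
      rw [slope_def_field, hF, mul_div_cancel_left₀ _ (sub_ne_zero.2 hy), Real.log_exp,
        ← intervalIntegral.integral_sub (hqc.intervalIntegrable _ _) (hc.intervalIntegrable _ _)]
      exact abs_integral_zero_le le_rfl fun u hu => (hq u).trans (by
        gcongr
        exact (abs_flow_sub_le hσ hC₁ hC₂ hF0 hFr hinj hu x y).1)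
    · have : Continuous fun y => C₂ * (Real.exp (C₁ * |r|) * |y - x|) * |r| := by fun_prop
      simpa using (this.tendsto x).mono_left nhdsWithin_le_nhds
  refine (Real.continuous_exp.continuousAt.tendsto.comp hlim).congr' ?_
  filter_upwards [self_mem_nhdsWithin] with y hy
  obtain ⟨q, -, -, -, hF⟩ := exists_flow_sub_eq hσ hC₁ hC₂ hF0 hFr hinj (Ne.symm hy : x ≠ y)
  rw [Function.comp_apply, Real.exp_log]
  rw [slope_def_field, hF, mul_div_cancel_left₀ _ (sub_ne_zero.2 hy)]
  exact Real.exp_pos _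

theorem deriv_flow_inverse (hσ : ContDiff ℝ 2 σ) (hC₁ : ∀ x, |deriv σ x| ≤ C₁)
    (hC₂ : ∀ x, |deriv (deriv σ) x| ≤ C₂) (hF0 : ∀ x : ℝ, F (0, x) = x)
    (hFr : ∀ r x : ℝ, HasDerivAt (fun r' : ℝ => F (r', x)) (σ (F (r, x))) r) {H : ℝ × ℝ → ℝ}
    (hH : ∀ r : ℝ, Function.LeftInverse (fun y : ℝ => H (r, y)) (fun x : ℝ => F (r, x)) ∧
      Function.RightInverse (fun y : ℝ => H (r, y)) (fun x : ℝ => F (r, x))) (r x : ℝ) :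
    deriv (fun y => H (r, y)) (F (r, x)) =
      Real.exp (-∫ u in (0:ℝ)..r, deriv σ (F (u, x))) := by
  have hinj : ∀ r, Function.Injective fun x => F (r, x) := fun r => (hH r).1.injective
  have hHc : Continuous fun y => H (r, y) := by
    refine (LipschitzWith.of_dist_le_mul (K := (Real.exp (C₁ * |r|)).toNNReal)
      fun y z => ?_).continuous
    have := (abs_flow_sub_le hσ hC₁ hC₂ hF0 hFr hinj (le_refl |r|) (H (r, z)) (H (r, y))).2
    have ey : F (r, H (r, y)) = y := (hH r).2 y
    have ez : F (r, H (r, z)) = z := (hH r).2 z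
    rw [ey, ez] at this
    rwa [Real.dist_eq, Real.dist_eq, Real.coe_toNNReal _ (Real.exp_pos _).le]
  have hx : H (r, F (r, x)) = x := (hH r).1 x
  have := HasDerivAt.of_local_left_inverse (f := fun y => F (r, y)) (g := fun y => H (r, y))
    (a := F (r, x)) hHc.continuousAt
    (by
      simp only [hx]
      exact hasDerivAt_flow hσ hC₁ hC₂ hF0 hFr hinj r x)
    (Real.exp_pos _).ne' (.of_forall fun y => (hH r).2 y)
  rw [this.deriv, Real.exp_neg]

end Flow

theorem le_mul_exp_of_le_add_integral {u : ℝ → ℝ} (hu : Continuous u) (hu0 : ∀ s, 0 ≤ u s)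
    {A K T : ℝ} (hK : 0 < K)
    (h : ∀ t ∈ Set.Icc 0 T, u t ≤ A + K * ∫ s in (0:ℝ)..t, u s) :
    ∀ t ∈ Set.Icc 0 T, u t ≤ A * Real.exp (K * t) := by
  intro t ht
  have hd : ∀ s, HasDerivAt (fun s => ∫ v in (0:ℝ)..s, u v) (u s) s := fun s =>
    (hu.integral_hasStrictDerivAt 0 s).hasDerivAt
  have := norm_le_gronwallBound_of_norm_deriv_right_le (f := fun s => ∫ v in (0:ℝ)..s, u v)
    (f' := u) (δ := 0) (K := K) (ε := A) (a := 0) (b := T)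
    (fun s _ => (hd s).continuousAt.continuousWithinAt)
    (fun s _ => (hd s).hasDerivWithinAt) (by simp)
    (fun s hs => by
      rw [Real.norm_of_nonneg (hu0 s)]
      have h1 := h s ⟨hs.1, hs.2.le⟩
      have h2 := mul_le_mul_of_nonneg_left (Real.le_norm_self (∫ v in (0:ℝ)..s, u v)) hK.le
      linarith) t ht
  rw [gronwallBound_of_K_ne_0 hK.ne', sub_zero] at this
  have h1 := (Real.le_norm_self _).trans this
  have h2 := mul_le_mul_of_nonneg_left h1 hK.le
  have h3 := h t ht
  have e : K * (0 * Real.exp (K * t) + A / K * (Real.exp (K * t) - 1))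
      = A * Real.exp (K * t) - A := by
    field_simp
    ring
  linarith

theorem sum_integral_abs_sub_grid {m : ℝ → ℝ} (hm : Continuous m) {T : ℝ} (hT : 0 < T) {n : ℕ}
    (hn : 1 ≤ n) :
    ∑ k ∈ Finset.range n, ∫ s in (k * (T / n))..((k + 1 : ℕ) * (T / n)), |m s - m (k * (T / n))| =
      ∫ s in (0:ℝ)..T, |m s - m ((⌊s * (n : ℝ) / T⌋ : ℝ) * (T / (n : ℝ)))| := by
  have hn0 : (0:ℝ) < n := by exact_mod_cast hn
  have hcongr : ∀ k : ℕ, Set.EqOn (fun s => |m s - m (k * (T / n))|)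
      (fun s => |m s - m ((⌊s * (n : ℝ) / T⌋ : ℝ) * (T / (n : ℝ)))|)
      (Set.uIoo ((k : ℝ) * (T / n)) ((k + 1 : ℕ) * (T / n))) := by
    intro k s hs
    rw [Set.uIoo_of_le (by gcongr; simp)] at hs
    have : ⌊s * (n : ℝ) / T⌋ = (k : ℤ) := by
      rw [Int.floor_eq_iff, le_div_iff₀ hT, div_lt_iff₀ hT]
      obtain ⟨h1, h2⟩ := hs
      rw [← mul_div_assoc, div_lt_iff₀ hn0] at h1
      rw [← mul_div_assoc, lt_div_iff₀ hn0] at h2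
      push_cast at h2 ⊢
      exact ⟨h1.le, h2⟩
    simp [this]
  have hint : ∀ k : ℕ, IntervalIntegrable (fun s => |m s - m (k * (T / n))|) volume
      ((k : ℝ) * (T / n)) ((k + 1 : ℕ) * (T / n)) := fun k =>
    Continuous.intervalIntegrable (by fun_prop) _ _
  have := sum_integral_adjacent_intervals (μ := volume)
    (f := fun s => |m s - m ((⌊s * (n : ℝ) / T⌋ : ℝ) * (T / (n : ℝ)))|)
    (a := fun k : ℕ => (k : ℝ) * (T / n)) (n := n)
    (fun k _ => (hint k).congr_uIoo (hcongr k))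
  simp only [Nat.cast_zero, zero_mul, mul_div_cancel₀ T hn0.ne'] at this
  rw [← this]
  exact Finset.sum_congr rfl fun k _ => integral_congr_uIoo (hcongr k)

theorem abs_integral_comp_div_le {f : ℝ → ℝ} (hf : Continuous f) {c ε : ℝ} (hε : 0 < ε)
    (hint : ∀ q, 0 ≤ q → |∫ τ in (0:ℝ)..q, f τ| ≤ c) {p q : ℝ} (hp : 0 ≤ p) (hq : 0 ≤ q) :
    |∫ s in p..q, f (s / ε)| ≤ 2 * c * ε := by
  rw [intervalIntegral.integral_comp_div _ hε.ne', smul_eq_mul, abs_mul, abs_of_pos hε,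
    ← integral_interval_sub_left (hf.intervalIntegrable 0 _) (hf.intervalIntegrable 0 _), mul_comm]
  gcongr
  refine (abs_sub _ _).trans ?_
  linarith [hint _ (div_nonneg hp hε.le), hint _ (div_nonneg hq hε.le)]

theorem abs_integral_le_of_grid {a : ℝ → ℝ → ℝ} (ha : Continuous fun p : ℝ × ℝ => a p.1 p.2)
    {m : ℝ → ℝ} (hm : Continuous m) {T Λ D c ε : ℝ} (hT : 0 < T) (hΛ : 0 ≤ Λ) (hD : 0 ≤ D)
    (hε : 0 < ε)
    (hlip : ∀ s ∈ Set.Icc 0 T, ∀ s' ∈ Set.Icc 0 T, ∀ τ,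
      |a s τ - a s' τ| ≤ Λ * (|m s - m s'| + D * |s - s'|))
    (hint : ∀ s ∈ Set.Icc 0 T, ∀ q, 0 ≤ q → |∫ τ in (0:ℝ)..q, a s τ| ≤ c)
    {n : ℕ} (hn : 1 ≤ n) {t : ℝ} (ht : t ∈ Set.Icc 0 T) :
    |∫ s in (0:ℝ)..t, a s (s / ε)| ≤
      Λ * ((∫ s in (0:ℝ)..T, |m s - m ((⌊s * (n : ℝ) / T⌋ : ℝ) * (T / (n : ℝ)))|)
        + D * T * (T / n)) + n * (2 * c * ε) := by
  have hn0 : (0:ℝ) < n := by exact_mod_cast hn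
  have hh : 0 < T / n := by positivity
  have hnT : (n : ℝ) * (T / n) = T := mul_div_cancel₀ T hn0.ne'
  have hc0 : 0 ≤ c := (abs_nonneg _).trans (hint 0 ⟨le_rfl, hT.le⟩ 0 le_rfl)
  have hcont : Continuous fun s => a s (s / ε) :=
    ha.comp (continuous_id.prodMk (continuous_id.div_const ε))
  have hcell : ∀ k < n, |∫ s in (min t (k * (T / n)))..(min t ((k + 1 : ℕ) * (T / n))), a s (s / ε)|
      ≤ Λ * (∫ s in (k * (T / n))..((k + 1 : ℕ) * (T / n)), |m s - m (k * (T / n))|)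
        + (Λ * (D * (T / n)) * (T / n) + 2 * c * ε) := by
    intro k hk
    have hx0 : 0 ≤ (k : ℝ) * (T / n) := by positivity
    have hxx : ((k + 1 : ℕ) : ℝ) * (T / n) = k * (T / n) + T / n := by push_cast; ring
    have hxT : ((k + 1 : ℕ) : ℝ) * (T / n) ≤ T := by
      refine le_trans ?_ hnT.le
      gcongr
      exact_mod_cast hk
    rw [hxx] at hxT ⊢
    set x : ℝ := k * (T / n)
    have hpos : 0 ≤ ∫ s in x..(x + T / n), |m s - m x| :=
      integral_nonneg (by linarith) fun s _ => abs_nonneg _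
    rcases le_total t x with htx | htx
    · rw [min_eq_left htx, min_eq_left (by linarith), integral_same, abs_zero]
      positivity
    rw [min_eq_right htx]
    set y := min t (x + T / n)
    have hxy : x ≤ y := le_min htx (by linarith)
    have hyx : y ≤ x + T / n := min_le_right _ _
    have hcx : Continuous fun s => a x (s / ε) :=
      ha.comp (continuous_const.prodMk (continuous_id.div_const ε))
    have hxm : x ∈ Set.Icc 0 T := ⟨hx0, by linarith⟩
    have e : ∫ s in x..y, a s (s / ε)
        = (∫ s in x..y, (a s (s / ε) - a x (s / ε))) + ∫ s in x..y, a x (s / ε) := by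
      rw [intervalIntegral.integral_sub (hcont.intervalIntegrable _ _) (hcx.intervalIntegrable _ _)]
      ring
    have hgc : Continuous fun s => Λ * (|m s - m x| + D * (T / n)) := by fun_prop
    have h1 : |∫ s in x..y, (a s (s / ε) - a x (s / ε))|
        ≤ ∫ s in x..y, Λ * (|m s - m x| + D * (T / n)) := by
      rw [← Real.norm_eq_abs]
      refine norm_integral_le_of_norm_le hxy (.of_forall fun s hs => ?_)
        (hgc.intervalIntegrable _ _)
      refine (hlip s ⟨by linarith [hs.1], by linarith [hs.2]⟩ x hxm _).trans ?_
      gcongr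
      rw [abs_of_nonneg (by linarith [hs.1])]
      linarith [hs.2]
    have h2 : ∫ s in x..y, Λ * (|m s - m x| + D * (T / n))
        ≤ ∫ s in x..(x + T / n), Λ * (|m s - m x| + D * (T / n)) :=
      integral_mono_interval le_rfl hxy hyx (.of_forall fun s => by simp only [Pi.zero_apply]; positivity)
        (hgc.intervalIntegrable _ _)
    have h3 : ∫ s in x..(x + T / n), Λ * (|m s - m x| + D * (T / n))
        = Λ * (∫ s in x..(x + T / n), |m s - m x|) + Λ * (D * (T / n)) * (T / n) := by
      rw [intervalIntegral.integral_const_mul, intervalIntegral.integral_add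
        (Continuous.intervalIntegrable (by fun_prop) _ _) (by simp), intervalIntegral.integral_const,
        smul_eq_mul]
      ring
    have h4 := abs_integral_comp_div_le (ha.comp (continuous_const.prodMk continuous_id)) hε
      (hint x hxm) hx0 (hx0.trans hxy)
    simp only [Function.comp_apply, id_eq] at h4
    rw [e]
    refine (abs_add_le _ _).trans ?_
    linarith
  have hsum := sum_integral_adjacent_intervals (μ := volume) (f := fun s => a s (s / ε))
    (a := fun k : ℕ => min t (k * (T / n))) (n := n) (fun k _ => hcont.intervalIntegrable _ _)
  simp only [Nat.cast_zero, zero_mul, hnT, min_eq_right ht.1, min_eq_left ht.2] at hsum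
  rw [← hsum, ← sum_integral_abs_sub_grid hm hT hn]
  refine (Finset.abs_sum_le_sum_abs _ _).trans
    ((Finset.sum_le_sum fun k hk => hcell k (Finset.mem_range.1 hk)).trans (le_of_eq ?_))
  rw [Finset.sum_add_distrib, ← Finset.mul_sum, Finset.sum_const, Finset.card_range, nsmul_eq_mul]
  linear_combination (Λ * D * (T / n)) * hnT

theorem exists_averaging_bound {Φ : ℝ → ℝ → ℝ → ℝ} {Φb : ℝ → ℝ → ℝ} {T : ℝ} (hT : 0 < T) (y₀ : ℝ)
    (hΦ : BoxLipschitz Φ) (hΦb : BoxLipschitz fun _ : ℝ => Φb)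
    (hΦc : Continuous fun p : ℝ × ℝ × ℝ => Φ p.1 p.2.1 p.2.2)
    (hΦbc : Continuous fun p : ℝ × ℝ => Φb p.1 p.2)
    {R D : ℝ} (hR : 0 ≤ R) (hD : ∀ τ r y, |r| ≤ R → |Φ τ r y| ≤ D)
    (hDb : ∀ r y, |r| ≤ R → |Φb r y| ≤ D)
    {c : ℝ} (hc : ∀ r y, |r| ≤ R → ∀ q, 0 ≤ q → |∫ τ in (0:ℝ)..q, (Φ τ r y - Φb r y)| ≤ c) :
    ∃ C : ℝ, 0 ≤ C ∧ ∀ m Y Yb : ℝ → ℝ, Continuous m → Continuous Y → Continuous Yb →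
      (∀ s ∈ Set.Icc 0 T, |m s| ≤ R) → ∀ ε, 0 < ε →
      (∀ t ∈ Set.Icc 0 T, Y t = y₀ + ∫ s in (0:ℝ)..t, Φ (s / ε) (m s) (Y s)) →
      (∀ t ∈ Set.Icc 0 T, Yb t = y₀ + ∫ s in (0:ℝ)..t, Φb (m s) (Yb s)) →
      ∀ n : ℕ, 1 ≤ n → ∀ t ∈ Set.Icc 0 T, |Y t - Yb t| ≤
        C * ((∫ s in (0:ℝ)..T, |m s - m ((⌊s * (n : ℝ) / T⌋ : ℝ) * (T / (n : ℝ)))|)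
          + 1 / n + n * ε) := by
  have hD0 : 0 ≤ D := (abs_nonneg _).trans (hDb 0 0 (by simpa))
  have hc0 : 0 ≤ c := (abs_nonneg _).trans (hc 0 0 (by simpa) 0 le_rfl)
  set K := R + (|y₀| + D * T)
  have hRK : R ≤ K := le_add_of_nonneg_right (by positivity)
  have hK0 : |y₀| + D * T ≤ K := le_add_of_nonneg_left hR
  obtain ⟨Λ, hΛ, hψ⟩ := (hΦ.sub hΦb) K (hR.trans hRK)
  obtain ⟨Λ₁, hΛ₁, hΦL⟩ := hΦ K (hR.trans hRK)
  refine ⟨(Λ + Λ * (D * T * T) + 2 * c) * Real.exp ((Λ₁ + 1) * T), by positivity, ?_⟩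
  intro m Y Yb hm hYc hYbc hmR ε hε hY hYb n hn t ht
  have hn0 : (0:ℝ) < n := by exact_mod_cast hn
  have hmem : ∀ {t s : ℝ}, t ∈ Set.Icc 0 T → s ∈ Set.uIoc 0 t → s ∈ Set.Icc 0 T := by
    intro t s ht hs
    rw [Set.uIoc_of_le ht.1] at hs
    exact ⟨hs.1.le, hs.2.trans ht.2⟩
  have hbd : ∀ f : ℝ → ℝ, (∀ s ∈ Set.Icc 0 T, |f s| ≤ D) → ∀ t ∈ Set.Icc 0 T,
      |y₀ + ∫ s in (0:ℝ)..t, f s| ≤ K := by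
    intro f hf t ht
    have h1 : ‖∫ s in (0:ℝ)..t, f s‖ ≤ D * |t - 0| :=
      norm_integral_le_of_norm_le_const fun s hs => hf s (hmem ht hs)
    rw [sub_zero, abs_of_nonneg ht.1, Real.norm_eq_abs] at h1
    have h2 : D * t ≤ D * T := mul_le_mul_of_nonneg_left ht.2 hD0
    linarith [abs_add_le y₀ (∫ s in (0:ℝ)..t, f s)]
  have hYK : ∀ s ∈ Set.Icc 0 T, |Y s| ≤ K := fun s hs => by
    rw [hY s hs]
    exact hbd _ (fun s hs => hD _ _ _ (hmR s hs)) s hs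
  have hYbK : ∀ s ∈ Set.Icc 0 T, |Yb s| ≤ K := fun s hs => by
    rw [hYb s hs]
    exact hbd _ (fun s hs => hDb _ _ (hmR s hs)) s hs
  have c1 : Continuous fun s => Φ (s / ε) (m s) (Y s) :=
    hΦc.comp ((continuous_id.div_const ε).prodMk (hm.prodMk hYc))
  have c2 : Continuous fun s => Φ (s / ε) (m s) (Yb s) :=
    hΦc.comp ((continuous_id.div_const ε).prodMk (hm.prodMk hYbc))
  have c3 : Continuous fun s => Φb (m s) (Yb s) := hΦbc.comp (hm.prodMk hYbc)
  have c4 : Continuous fun p : ℝ × ℝ => Φ p.2 (m p.1) (Yb p.1) - Φb (m p.1) (Yb p.1) :=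
    (hΦc.comp (continuous_snd.prodMk
      ((hm.comp continuous_fst).prodMk (hYbc.comp continuous_fst)))).sub (c3.comp continuous_fst)
  have hYblip : ∀ s ∈ Set.Icc 0 T, ∀ s' ∈ Set.Icc 0 T, |Yb s - Yb s'| ≤ D * |s - s'| := by
    intro s hs s' hs'
    rw [hYb s hs, hYb s' hs', add_sub_add_left_eq_sub, integral_interval_sub_left
      (c3.intervalIntegrable _ _) (c3.intervalIntegrable _ _)]
    exact norm_integral_le_of_norm_le_const (f := fun s => Φb (m s) (Yb s)) fun u hu => hDb _ _
      (hmR u (Set.uIcc_subset_Icc hs' hs (Set.uIoc_subset_uIcc hu)))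
  set I := ∫ s in (0:ℝ)..T, |m s - m ((⌊s * (n : ℝ) / T⌋ : ℝ) * (T / (n : ℝ)))|
  have hI : 0 ≤ I := integral_nonneg hT.le fun s _ => abs_nonneg _
  have hosc : ∀ t ∈ Set.Icc 0 T,
      |∫ s in (0:ℝ)..t, (Φ (s / ε) (m s) (Yb s) - Φb (m s) (Yb s))| ≤
        Λ * (I + D * T * (T / n)) + n * (2 * c * ε) := fun t ht =>
    abs_integral_le_of_grid (a := fun s τ => Φ τ (m s) (Yb s) - Φb (m s) (Yb s)) c4 hm hT hΛ hD0 hε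
      (fun s hs s' hs' τ => ((hψ τ (m s) (m s') (Yb s) (Yb s') ((hmR s hs).trans hRK)
        ((hmR s' hs').trans hRK) (hYbK s hs) (hYbK s' hs')).2).trans (by
          gcongr
          exact hYblip s hs s' hs'))
      (fun s hs q hq => hc _ _ (hmR s hs) q hq) hn ht
  have hgron := le_mul_exp_of_le_add_integral (u := fun s => |Y s - Yb s|) (hYc.sub hYbc).abs
    (fun s => abs_nonneg _) (A := Λ * (I + D * T * (T / n)) + n * (2 * c * ε)) (K := Λ₁ + 1)
    (T := T) (by positivity) (fun t ht => by
      have e : Y t - Yb t = (∫ s in (0:ℝ)..t, (Φ (s / ε) (m s) (Y s) - Φ (s / ε) (m s) (Yb s)))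
          + ∫ s in (0:ℝ)..t, (Φ (s / ε) (m s) (Yb s) - Φb (m s) (Yb s)) := by
        rw [hY t ht, hYb t ht,
          intervalIntegral.integral_sub (c1.intervalIntegrable _ _) (c2.intervalIntegrable _ _),
          intervalIntegral.integral_sub (c2.intervalIntegrable _ _) (c3.intervalIntegrable _ _)]
        ring
      have h1 : ‖∫ s in (0:ℝ)..t, (Φ (s / ε) (m s) (Y s) - Φ (s / ε) (m s) (Yb s))‖
          ≤ ∫ s in (0:ℝ)..t, (Λ₁ + 1) * |Y s - Yb s| := by
        refine norm_integral_le_of_norm_le ht.1 (.of_forall fun s hs => ?_)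
          (Continuous.intervalIntegrable (by fun_prop) _ _)
        have hs' : s ∈ Set.Icc 0 T := ⟨hs.1.le, hs.2.trans ht.2⟩
        have h := (hΦL (s / ε) (m s) (m s) (Y s) (Yb s) ((hmR s hs').trans hRK)
          ((hmR s hs').trans hRK) (hYK s hs') (hYbK s hs')).2
        rw [sub_self, abs_zero, zero_add] at h
        rw [Real.norm_eq_abs]
        linarith [abs_nonneg (Y s - Yb s)]
      rw [intervalIntegral.integral_const_mul, Real.norm_eq_abs] at h1
      rw [e]
      refine (abs_add_le _ _).trans ?_
      linarith [hosc t ht]) t ht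
  refine hgron.trans ?_
  have h1 : Λ * (I + D * T * (T / n)) + n * (2 * c * ε)
      ≤ (Λ + Λ * (D * T * T) + 2 * c) * (I + 1 / n + n * ε) := by
    have e : Λ * (I + D * T * (T / n)) + n * (2 * c * ε)
        = Λ * I + Λ * (D * T * T) * (1 / n) + 2 * c * (n * ε) := by ring
    rw [e]
    have a1 : 0 ≤ (1:ℝ) / n := by positivity
    have a2 : 0 ≤ n * ε := by positivity
    have a3 : Λ * I ≤ Λ * (I + 1 / n + n * ε) := by gcongr; linarith
    have a4 : Λ * (D * T * T) * (1 / n) ≤ Λ * (D * T * T) * (I + 1 / n + n * ε) := by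
      gcongr; linarith
    have a5 : 2 * c * (n * ε) ≤ 2 * c * (I + 1 / n + n * ε) := by gcongr; linarith
    linarith
  calc (Λ * (I + D * T * (T / n)) + n * (2 * c * ε)) * Real.exp ((Λ₁ + 1) * t)
      ≤ ((Λ + Λ * (D * T * T) + 2 * c) * (I + 1 / n + n * ε)) * Real.exp ((Λ₁ + 1) * T) := by
        gcongr
        exact ht.2
    _ = _ := by ring

theorem boxLipschitz_of_locally_lipschitz {β : ℝ → ℝ → ℝ} {B : ℝ} (hB : ∀ t x, |β t x| ≤ B)
    {L : ℝ → ℝ} (hL : ∀ c, 0 < c → ∀ x y t, |x| ≤ c → |y| ≤ c → |β t x - β t y| ≤ L c * |x - y|) :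
    BoxLipschitz fun t (_ : ℝ) x => β t x := by
  intro R hR
  have hB0 : 0 ≤ B := (abs_nonneg _).trans (hB 0 0)
  refine ⟨B + |L (R + 1)|, by positivity, fun t r r' x x' _ _ hx hx' => ⟨?_, ?_⟩⟩
  · linarith [hB t x, abs_nonneg (L (R + 1))]
  · refine (hL (R + 1) (by linarith) x x' t (by linarith) (by linarith)).trans ?_
    gcongr
    · linarith [le_abs_self (L (R + 1))]
    · linarith [abs_nonneg (r - r')]

theorem abs_average_le {f : ℝ → ℝ} {l K : ℝ} (hf : ∀ s, |f s| ≤ K)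
    (hl : Tendsto (fun t : ℝ => (1 / t) * ∫ s in (0:ℝ)..t, f s) atTop (nhds l)) : |l| ≤ K := by
  refine le_of_tendsto hl.abs ?_
  filter_upwards [eventually_gt_atTop 0] with t ht
  have := abs_integral_zero_le (R := t) (r := t) (abs_of_pos ht).le (fun u _ => hf u)
  rw [abs_of_pos ht] at this
  rw [abs_mul, abs_of_pos (by positivity), one_div, inv_mul_le_iff₀ ht]
  linarith

theorem abs_average_sub_le {b : ℝ × ℝ → ℝ} (hbc : Continuous b) {bbar : ℝ → ℝ}
    (hbar : ∀ y : ℝ, Tendsto (fun t : ℝ => (1 / t) * ∫ s in (0:ℝ)..t, b (y, s))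
      atTop (nhds (bbar y))) {x y K : ℝ} (hK : ∀ t, |b (x, t) - b (y, t)| ≤ K) :
    |bbar x - bbar y| ≤ K := by
  refine abs_average_le hK (((hbar x).sub (hbar y)).congr fun t => ?_)
  have hc : ∀ z, Continuous fun s => b (z, s) := fun z => by fun_prop
  rw [intervalIntegral.integral_sub ((hc x).intervalIntegrable _ _)
    ((hc y).intervalIntegrable _ _), mul_sub]

theorem SolvesAveragingODE.eq_add_integral_of_eqOn {F H : ℝ × ℝ → ℝ} {b : ℝ × ℝ → ℝ} {m : ℝ → ℝ}
    {T x₀ ε : ℝ} {Y : ℝ → ℝ} (h : SolvesAveragingODE F H b m T x₀ ε Y) {m' Y' : ℝ → ℝ}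
    (hm : Set.EqOn m' m (Set.Icc 0 T)) (hY : Set.EqOn Y' Y (Set.Icc 0 T)) {g : ℝ → ℝ → ℝ}
    (hg : ∀ r x, deriv (fun y => H (r, y)) (F (r, x)) = g r x) :
    ∀ t ∈ Set.Icc 0 T, Y' t = H (0, x₀) +
      ∫ s in (0:ℝ)..t, g (m' s) (Y' s) * b (F (m' s, Y' s), s / ε) := by
  intro t ht
  rw [hY ht, h.2 t ht]
  congr 1
  refine integral_congr fun s hs => ?_
  have hs' : s ∈ Set.Icc 0 T := Set.uIcc_subset_Icc ⟨le_rfl, ht.1.trans ht.2⟩ ht hs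
  simp only [hm hs', hY hs', hg]

theorem floor_mul_mem_Icc {T : ℝ} (hT : 0 < T) {n : ℕ} (hn : 1 ≤ n) {s : ℝ}
    (hs : s ∈ Set.Icc 0 T) :
    (⌊s * (n : ℝ) / T⌋ : ℝ) * (T / (n : ℝ)) ∈ Set.Icc 0 T := by
  have hn0 : (0:ℝ) < n := by exact_mod_cast hn
  have h0 : 0 ≤ s * (n : ℝ) / T := div_nonneg (mul_nonneg hs.1 hn0.le) hT.le
  have h1 : (0:ℝ) ≤ ⌊s * (n : ℝ) / T⌋ := by exact_mod_cast Int.floor_nonneg.2 h0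
  refine ⟨by positivity, le_trans ?_ hs.2⟩
  calc (⌊s * (n : ℝ) / T⌋ : ℝ) * (T / (n : ℝ)) ≤ s * (n : ℝ) / T * (T / n) := by
        gcongr
        exact Int.floor_le _
    _ = s := by field_simp

theorem exists_flow_averaging_bound {σ : ℝ → ℝ} {C₁ C₂ : ℝ} {F H b : ℝ × ℝ → ℝ}
    (hσ : ContDiff ℝ 2 σ) (hC₁ : ∀ x, |deriv σ x| ≤ C₁)
    (hC₂ : ∀ x, |deriv (deriv σ) x| ≤ C₂) (hF0 : ∀ x : ℝ, F (0, x) = x)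
    (hFr : ∀ r x : ℝ, HasDerivAt (fun r' : ℝ => F (r', x)) (σ (F (r, x))) r)
    (hH : ∀ r : ℝ, Function.LeftInverse (fun y : ℝ => H (r, y)) (fun x : ℝ => F (r, x)) ∧
      Function.RightInverse (fun y : ℝ => H (r, y)) (fun x : ℝ => F (r, x)))
    (hbc : Continuous b) {B : ℝ} (hB : ∀ p, |b p| ≤ B) {L : ℝ → ℝ}
    (hbL : ∀ c : ℝ, 0 < c → ∀ x y t : ℝ, |x| ≤ c → |y| ≤ c →
      |b (x, t) - b (y, t)| ≤ L c * |x - y|)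
    {bbar : ℝ → ℝ}
    (hbar : ∀ y : ℝ, Tendsto (fun t : ℝ => (1 / t) * ∫ s in (0:ℝ)..t, b (y, s))
      atTop (nhds (bbar y)))
    {M : ℝ} (hG : ∀ y : ℝ, ∀ r : ℝ, 0 ≤ r → |∫ s in (0:ℝ)..r, (b (y, s) - bbar y)| ≤ M)
    {T : ℝ} (hT : 0 < T) (x₀ : ℝ) {R : ℝ} (hR : 0 ≤ R) :
    ∃ C : ℝ, 0 ≤ C ∧ ∀ m Y Yb : ℝ → ℝ, ContinuousOn m (Set.Icc 0 T) →
      (∀ s ∈ Set.Icc 0 T, |m s| ≤ R) → ∀ ε, 0 < ε → SolvesAveragingODE F H b m T x₀ ε Y →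
      SolvesAveragingODE F H (fun p : ℝ × ℝ => bbar p.1) m T x₀ 1 Yb →
      ∀ n : ℕ, 1 ≤ n → ∀ t ∈ Set.Icc 0 T, |F (m t, Y t) - F (m t, Yb t)| ≤
        C * ((∫ s in (0:ℝ)..T, |m s - m ((⌊s * (n : ℝ) / T⌋ : ℝ) * (T / (n : ℝ)))|)
          + 1 / n + n * ε) := by
  have hinj : ∀ r, Function.Injective fun x => F (r, x) := fun r => (hH r).1.injective
  set g : ℝ → ℝ → ℝ := fun r x => Real.exp (-∫ u in (0:ℝ)..r, deriv σ (F (u, x)))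
  have hgH : ∀ r x, deriv (fun y => H (r, y)) (F (r, x)) = g r x :=
    deriv_flow_inverse hσ hC₁ hC₂ hF0 hFr hH
  have hgL : ∀ {ι : Type}, BoxLipschitz fun (_ : ι) => g := fun {ι} =>
    (BoxLipschitz.of_abs_deriv_le (h := fun x => Real.exp (-x)) (h' := fun x => -Real.exp (-x))
      (fun x => by simpa using (hasDerivAt_id x).neg.exp) (by fun_prop)).comp
      (boxLipschitz_integral_deriv_flow hσ hC₁ hC₂ hF0 hFr hinj (ι := ι))
  have hFL : ∀ {ι : Type}, BoxLipschitz fun (_ : ι) r x => F (r, x) := fun {ι} =>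
    boxLipschitz_flow hσ hC₁ hC₂ hF0 hFr hinj
  have hbarL : BoxLipschitz fun (_ _ : ℝ) x => bbar x :=
    boxLipschitz_of_locally_lipschitz (β := fun _ x => bbar x)
      (fun _ x => abs_average_le (fun s => hB (x, s)) (hbar x))
      (fun c hc x y _ hx hy => abs_average_sub_le hbc hbar fun t => hbL c hc x y t hx hy)
  have hΦ : BoxLipschitz fun τ r x => g r x * b (F (r, x), τ) :=
    hgL.mul ((boxLipschitz_of_locally_lipschitz (β := fun t x => b (x, t)) (fun t x => hB (x, t))
      (fun c hc x y t hx hy => hbL c hc x y t hx hy)).comp hFL)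
  have hΦb : BoxLipschitz fun (_ : ℝ) r x => g r x * bbar (F (r, x)) := hgL.mul (hbarL.comp hFL)
  have hgc := (hgL (ι := Unit)).continuous
  have hFc := (hFL (ι := Unit)).continuous
  have hΦc : Continuous fun p : ℝ × ℝ × ℝ => g p.2.1 p.2.2 * b (F (p.2.1, p.2.2), p.1) :=
    (hgc.comp continuous_snd).mul (hbc.comp ((hFc.comp continuous_snd).prodMk continuous_fst))
  have hΦbc : Continuous fun p : ℝ × ℝ => g p.1 p.2 * bbar (F (p.1, p.2)) :=
    BoxLipschitz.continuous (F := fun r x => g r x * bbar (F (r, x))) fun R hR => by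
      obtain ⟨C, hC, h⟩ := hΦb R hR
      exact ⟨C, hC, fun _ => h 0⟩
  have hg : ∀ r x, |r| ≤ R → |g r x| ≤ Real.exp (C₁ * R) := by
    intro r x hr
    rw [Real.abs_exp]
    gcongr
    have h1 := abs_integral_zero_le (R := R) hr (fun u _ => hC₁ (F (u, x)))
    have h2 : C₁ * |r| ≤ C₁ * R := mul_le_mul_of_nonneg_left hr ((abs_nonneg _).trans (hC₁ 0))
    linarith [neg_abs_le (∫ u in (0:ℝ)..r, deriv σ (F (u, x)))]
  have hprod : ∀ r x v K, |r| ≤ R → |v| ≤ K → |g r x * v| ≤ Real.exp (C₁ * R) * K := by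
    intro r x v K hr hv
    rw [abs_mul]
    exact mul_le_mul (hg r x hr) hv (abs_nonneg _) (Real.exp_pos _).le
  obtain ⟨C, hC, h⟩ := exists_averaging_bound hT (H (0, x₀)) hΦ hΦb hΦc hΦbc hR
    (D := Real.exp (C₁ * R) * B) (c := Real.exp (C₁ * R) * M)
    (fun τ r y hr => hprod r y _ _ hr (hB _))
    (fun r y hr => hprod r y _ _ hr (abs_average_le (fun s => hB (_, s)) (hbar _)))
    (fun r y hr q hq => by
      simp_rw [← mul_sub]
      rw [intervalIntegral.integral_const_mul]
      exact hprod r y _ _ hr (hG _ q hq))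
  refine ⟨Real.exp (C₁ * R) * C, by positivity, fun m Y Yb hmc hmR ε hε hY hYb n hn t ht => ?_⟩
  have hext : ∀ f : ℝ → ℝ, ContinuousOn f (Set.Icc 0 T) →
      ∃ f' : ℝ → ℝ, Continuous f' ∧ Set.EqOn f' f (Set.Icc 0 T) := fun f hf =>
    ⟨Set.IccExtend hT.le ((Set.Icc 0 T).domRestrict f), hf.domRestrict.Icc_extend', fun s hs => by
      rw [Set.IccExtend_of_mem _ _ hs, Set.domRestrict_apply]⟩
  obtain ⟨m', hm'c, hm'⟩ := hext m hmc
  obtain ⟨Y', hY'c, hY'⟩ := hext Y hY.1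
  obtain ⟨Yb', hYb'c, hYb'⟩ := hext Yb hYb.1
  have key := h m' Y' Yb' hm'c hY'c hYb'c (fun s hs => by rw [hm' hs]; exact hmR s hs) ε hε
    (hY.eq_add_integral_of_eqOn hm' hY' hgH) (hYb.eq_add_integral_of_eqOn hm' hYb' hgH) n hn t ht
  have hI : ∫ s in (0:ℝ)..T, |m' s - m' ((⌊s * (n : ℝ) / T⌋ : ℝ) * (T / (n : ℝ)))|
      = ∫ s in (0:ℝ)..T, |m s - m ((⌊s * (n : ℝ) / T⌋ : ℝ) * (T / (n : ℝ)))| :=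
    integral_congr fun s hs => by
      rw [Set.uIcc_of_le hT.le] at hs
      simp only [hm' hs, hm' (floor_mul_mem_Icc hT hn hs)]
  rw [hI, hY' ht, hYb' ht] at key
  rw [mul_assoc]
  exact (abs_flow_sub_le hσ hC₁ hC₂ hF0 hFr hinj (hmR t ht) (Yb t) (Y t)).1.trans
    (mul_le_mul_of_nonneg_left key (Real.exp_pos _).le)

theorem tendsto_measure_exists_lt_abs {Ω : Type*} [MeasurableSpace Ω] (P : Measure Ω)
    [IsProbabilityMeasure P] {T : ℝ} {μ : Ω → ℝ → ℝ}
    (hμc : ∀ ω, ContinuousOn (μ ω) (Set.Icc 0 T)) (hμ : ∀ s : ℝ, Measurable fun ω => μ ω s) :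
    Tendsto (fun N : ℕ => P {ω | ∃ s ∈ Set.Icc 0 T, (N : ℝ) < |μ ω s|}) atTop (nhds 0) := by
  obtain ⟨S, hSc, hSd⟩ := TopologicalSpace.exists_countable_dense (Set.Icc (0:ℝ) T)
  have hmeas : ∀ N : ℕ, MeasurableSet {ω | ∃ s ∈ Set.Icc 0 T, (N : ℝ) < |μ ω s|} := by
    intro N
    have e : {ω | ∃ s ∈ Set.Icc 0 T, (N : ℝ) < |μ ω s|} =
        ⋃ s ∈ S, {ω | (N : ℝ) < |μ ω (s : ℝ)|} := by
      ext ω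
      simp only [Set.mem_ofPred_eq, Set.mem_iUnion, exists_prop]
      constructor
      · rintro ⟨s, hs, h⟩
        have hopen : IsOpen {s : Set.Icc (0:ℝ) T | (N : ℝ) < |μ ω s|} :=
          isOpen_lt continuous_const (hμc ω).domRestrict.abs
        obtain ⟨q, hq, hqS⟩ := hSd.inter_open_nonempty _ hopen ⟨⟨s, hs⟩, h⟩
        exact ⟨q, hqS, hq⟩
      · rintro ⟨s, -, h⟩
        exact ⟨s, s.2, h⟩
    rw [e]
    exact .biUnion hSc fun s _ => measurableSet_lt measurable_const (hμ s).abs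
  have hanti : Antitone fun N : ℕ => {ω | ∃ s ∈ Set.Icc 0 T, (N : ℝ) < |μ ω s|} := by
    rintro N N' hNN ω ⟨s, hs, h⟩
    exact ⟨s, hs, lt_of_le_of_lt (by exact_mod_cast hNN) h⟩
  have hempty : ⋂ N : ℕ, {ω | ∃ s ∈ Set.Icc 0 T, (N : ℝ) < |μ ω s|} = ∅ := by
    refine Set.eq_empty_of_forall_notMem fun ω hω => ?_
    obtain ⟨K, hK⟩ := isCompact_Icc.exists_bound_of_continuousOn (hμc ω)
    obtain ⟨N, hN⟩ := exists_nat_ge K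
    obtain ⟨s, hs, h⟩ := Set.mem_iInter.1 hω N
    exact absurd ((hK s hs).trans hN) (not_le.2 h)
  have := tendsto_measure_iInter_atTop (μ := P) (fun N => (hmeas N).nullMeasurableSet) hanti
    ⟨0, measure_ne_top _ _⟩
  rwa [hempty, measure_empty] at this

theorem grid_error_le {T I c θ : ℝ} (hT : 0 < T) (hI : 0 ≤ I) (hθ : 0 < θ) (hθ1 : θ ≤ 1) {n : ℕ}
    (hn : n = ⌈(θ ^ 2)⁻¹⌉₊) (h : √((n : ℝ) / T) * I ≤ c) :
    I + 1 / n + n * θ ^ 3 ≤ (c * √T + 3) * θ := by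
  have h1 : (θ ^ 2)⁻¹ ≤ n := hn ▸ Nat.le_ceil _
  have h2 : (n : ℝ) < (θ ^ 2)⁻¹ + 1 := hn ▸ Nat.ceil_lt_add_one (by positivity)
  have hn0 : (0:ℝ) < n := lt_of_lt_of_le (by positivity) h1
  have hsT : 0 < √T := Real.sqrt_pos.2 hT
  have e1 : 1 / (n : ℝ) ≤ θ := by
    rw [one_div]
    calc (n : ℝ)⁻¹ ≤ θ ^ 2 := inv_le_of_inv_le₀ (by positivity) h1
      _ ≤ θ := by nlinarith
  have e2 : n * θ ^ 3 ≤ 2 * θ := by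
    calc n * θ ^ 3 ≤ ((θ ^ 2)⁻¹ + 1) * θ ^ 3 := by gcongr
      _ = θ + θ ^ 3 := by field_simp
      _ ≤ 2 * θ := by nlinarith [mul_pos hθ hθ]
  have e3 : I ≤ c * √T * θ := by
    have h3 : θ⁻¹ ≤ √n := Real.le_sqrt_of_sq_le (by rwa [inv_pow])
    have h4 : θ⁻¹ / √T * I ≤ c := le_trans (by rw [Real.sqrt_div hn0.le]; gcongr) h
    rw [div_mul_eq_mul_div, div_le_iff₀ hsT, inv_mul_le_iff₀ hθ] at h4
    linarith
  linarith

/-- Assume that the family of random variables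
`ζ_n ω := (n/T)^{1/2} ∫₀^T |μ_s ω − μ_{⌊s n/T⌋ T/n} ω| ds`, `n ≥ 1`, is bounded in
probability.  Then for every `α ∈ (0, 1/3)`,
`ε^{−α} · sup_{t ∈ [0,T]} |X^ε_t − X̄_t| → 0` in probability as `ε → 0⁺`, where
`X^ε_t ω = F (μ_t ω, Y^ε_t ω)` and `X̄_t ω = F (μ_t ω, Ȳ_t ω)`. -/
theorem averaging_rate_in_probability_sub_cubic
    (σ : ℝ → ℝ) (hσ : ContDiff ℝ 2 σ)
    (C₁ : ℝ) (hC₁ : ∀ x, |deriv σ x| ≤ C₁)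
    (C₂ : ℝ) (hC₂ : ∀ x, |deriv (deriv σ) x| ≤ C₂)
    (F H : ℝ × ℝ → ℝ)
    (hF0 : ∀ x : ℝ, F (0, x) = x)
    (hFr : ∀ r x : ℝ, HasDerivAt (fun r' : ℝ => F (r', x)) (σ (F (r, x))) r)
    (hH : ∀ r : ℝ, Function.LeftInverse (fun y : ℝ => H (r, y)) (fun x : ℝ => F (r, x)) ∧
      Function.RightInverse (fun y : ℝ => H (r, y)) (fun x : ℝ => F (r, x)))
    (b : ℝ × ℝ → ℝ) (hbc : Continuous b)
    (B : ℝ) (hB : ∀ p, |b p| ≤ B)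
    (L : ℝ → ℝ)
    (hbL : ∀ c : ℝ, 0 < c → ∀ x y t : ℝ, |x| ≤ c → |y| ≤ c →
      |b (x, t) - b (y, t)| ≤ L c * |x - y|)
    (bbar : ℝ → ℝ)
    (hbar : ∀ y : ℝ, Tendsto (fun t : ℝ => (1 / t) * ∫ s in (0:ℝ)..t, b (y, s))
      atTop (nhds (bbar y)))
    (M : ℝ)
    (hG : ∀ y : ℝ, ∀ r : ℝ, 0 ≤ r → |∫ s in (0:ℝ)..r, (b (y, s) - bbar y)| ≤ M)
    (T : ℝ) (hT : 0 < T) (x₀ : ℝ)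
    {Ω : Type*} [MeasurableSpace Ω] (P : Measure Ω) [IsProbabilityMeasure P]
    (μ : Ω → ℝ → ℝ)
    (hμc : ∀ ω, ContinuousOn (μ ω) (Set.Icc 0 T))
    (hμ0 : ∀ ω, μ ω 0 = 0)
    (hμmeas : ∀ s : ℝ, Measurable fun ω => μ ω s)
    (Y : ℝ → Ω → ℝ → ℝ)
    (hY : ∀ ε : ℝ, 0 < ε → ∀ ω, SolvesAveragingODE F H b (μ ω) T x₀ ε (Y ε ω))
    (Ybar : Ω → ℝ → ℝ)
    (hYbar : ∀ ω, SolvesAveragingODE F H (fun p : ℝ × ℝ => bbar p.1) (μ ω) T x₀ 1 (Ybar ω))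
    (hζ : BoundedInProbability P
      (fun (n : {n : ℕ // 1 ≤ n}) ω =>
        Real.sqrt ((n : ℝ) / T) *
          ∫ s in (0:ℝ)..T, |μ ω s - μ ω ((⌊s * (n : ℝ) / T⌋ : ℝ) * (T / (n : ℝ)))|))
    :
    ∀ α : ℝ, 0 < α → α < 1/3 → ∀ δ : ℝ, 0 < δ →
      Tendsto
        (fun ε : ℝ => P {ω |
          δ ≤ abs (ε ^ (-α) *
            ⨆ t : Set.Icc (0:ℝ) T, |F (μ ω t, Y ε ω t) - F (μ ω t, Ybar ω t)|) })
        (nhdsWithin 0 (Set.Ioi 0)) (nhds 0) := by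
  intro α hα hα3 δ hδ
  refine ENNReal.tendsto_nhds_zero.2 fun η hη => ?_
  have hη2 : 0 < η / 2 := ENNReal.half_pos hη.ne'
  obtain ⟨c, hc, hc0⟩ := ((ENNReal.tendsto_nhds_zero.1 hζ _ hη2).and (eventually_ge_atTop 0)).exists
  obtain ⟨N, hN⟩ := (ENNReal.tendsto_nhds_zero.1
    (tendsto_measure_exists_lt_abs P hμc hμmeas) _ hη2).exists
  obtain ⟨C, hC, hbound⟩ := exists_flow_averaging_bound hσ hC₁ hC₂ hF0 hFr hH hbc hB hbL hbar hG hT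
    x₀ (Nat.cast_nonneg N : (0:ℝ) ≤ N)
  have hlim : Tendsto (fun ε : ℝ => C * (c * √T + 3) * ε ^ (1 / 3 - α)) (nhdsWithin 0 (Set.Ioi 0))
      (nhds 0) := by
    have h := (Real.continuousAt_rpow_const 0 (1 / 3 - α) (.inr (by linarith))).tendsto
    rw [Real.zero_rpow (by linarith)] at h
    simpa using (h.mono_left nhdsWithin_le_nhds).const_mul (C * (c * √T + 3))
  filter_upwards [hlim.eventually_lt_const hδ, self_mem_nhdsWithin,
    nhdsWithin_le_nhds (Iio_mem_nhds one_pos)] with ε hεδ hε hε1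
  rw [Set.mem_Ioi] at hε
  rw [Set.mem_Iio] at hε1
  set θ : ℝ := ε ^ (1 / 3 : ℝ)
  have hθ : 0 < θ := Real.rpow_pos_of_pos hε _
  have hθ1 : θ ≤ 1 := Real.rpow_le_one hε.le hε1.le (by norm_num)
  have hθ3 : θ ^ 3 = ε := by
    rw [← Real.rpow_natCast, ← Real.rpow_mul hε.le]
    norm_num
  set n := ⌈(θ ^ 2)⁻¹⌉₊ with hn_def
  have hn : 1 ≤ n := Nat.ceil_pos.2 (by positivity)
  refine (measure_mono (t := {ω | ∃ s ∈ Set.Icc 0 T, (N : ℝ) < |μ ω s|} ∪ {ω | c ≤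
    abs (√((n : ℝ) / T) *
      ∫ s in (0:ℝ)..T, |μ ω s - μ ω ((⌊s * (n : ℝ) / T⌋ : ℝ) * (T / (n : ℝ)))|)}) ?_).trans
    ((measure_union_le _ _).trans ?_)
  · intro ω hω
    by_contra hcon
    simp only [Set.mem_union, Set.mem_ofPred_eq, not_or, not_exists, not_and, not_lt,
      not_le] at hcon
    obtain ⟨hμN, hζn⟩ := hcon
    have hI : 0 ≤ ∫ s in (0:ℝ)..T, |μ ω s - μ ω ((⌊s * (n : ℝ) / T⌋ : ℝ) * (T / (n : ℝ)))| :=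
      integral_nonneg hT.le fun s _ => abs_nonneg _
    have herr := grid_error_le hT hI hθ hθ1 hn_def ((le_abs_self _).trans hζn.le)
    rw [hθ3] at herr
    have hsup : ⨆ t : Set.Icc (0:ℝ) T, |F (μ ω t, Y ε ω t) - F (μ ω t, Ybar ω t)| ≤
        C * ((c * √T + 3) * θ) :=
      Real.iSup_le (fun t => (hbound (μ ω) (Y ε ω) (Ybar ω) (hμc ω) hμN ε hε (hY ε hε ω) (hYbar ω)
        n hn t t.2).trans (mul_le_mul_of_nonneg_left herr hC)) (by positivity)
    have hsup0 : 0 ≤ ⨆ t : Set.Icc (0:ℝ) T, |F (μ ω t, Y ε ω t) - F (μ ω t, Ybar ω t)| :=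
      Real.iSup_nonneg fun t => abs_nonneg _
    have hω' : δ ≤ abs (ε ^ (-α) *
      ⨆ t : Set.Icc (0:ℝ) T, |F (μ ω t, Y ε ω t) - F (μ ω t, Ybar ω t)|) := hω
    rw [abs_of_nonneg (by positivity)] at hω'
    have hle := mul_le_mul_of_nonneg_left hsup (Real.rpow_nonneg hε.le (-α))
    have e : ε ^ (-α) * (C * ((c * √T + 3) * θ)) = C * (c * √T + 3) * ε ^ (1 / 3 - α) := by
      rw [sub_eq_add_neg, Real.rpow_add hε]
      ring
    linarith
  · rw [← ENNReal.add_halves η]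
    exact add_le_add hN ((le_iSup (fun i : {n : ℕ // 1 ≤ n} => P {ω | c ≤ abs (√((i : ℝ) / T) *
      ∫ s in (0:ℝ)..T, |μ ω s - μ ω ((⌊s * (i : ℝ) / T⌋ : ℝ) * (T / (i : ℝ)))|)})
      ⟨n, hn⟩).trans hc)
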